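/- Let G be a multigraph on n ≥ 2 vertices with minimum cut value c ≥ 1, and suppose each edge fails independently with probability p ∈ [0,1], where p^c = n^{-(2+δ)} for some real δ > 0. Then for every integer u ≥ 1, the probability that the failed edge set contains the edge sets of at least u distinct cuts of G is at most n^{-⌈log₂(u+1)+1⌉·δ/2}. -/

import Mathlib

open scoped Classical

/-- A multigraph on vertex type `V` is given by an edge-index type `E` together with a map
`ends : E → Sym2 V` assigning to each edge its (unordered) pair of endpoints; the hypothesis
`∀ e, ¬ (ends e).IsDiag` says that the two endpoints of every edge are distinct.
`survGraph ends F` is the simple graph on `V` whose adjacencies are given by the edges of the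
multigraph that survive when the edges in `F` fail. -/
def survGraph {V E : Type} (ends : E → Sym2 V) (F : Finset E) : SimpleGraph V :=
  SimpleGraph.fromRel (fun x y => ∃ e, e ∉ F ∧ ends e = s(x, y))

/-- The number of connected components of the graph surviving after the edges in `F` fail. -/
noncomputable def numComponents {V E : Type} (ends : E → Sym2 V) (F : Finset E) : ℕ :=
  Nat.card (survGraph ends F).ConnectedComponent

/-- Edge `e` crosses the 2-way cut determined by the vertex set `A` (one endpoint in `A`,
one endpoint outside `A`). -/
def crosses {V E : Type} (ends : E → Sym2 V) (A : Finset V) (e : E) : Prop :=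
  (∃ x ∈ ends e, x ∈ A) ∧ (∃ x ∈ ends e, x ∉ A)

/-- The edge set of the 2-way cut determined by the vertex set `A`. -/
noncomputable def cutEdges {V E : Type} [Fintype E] (ends : E → Sym2 V) (A : Finset V) :
    Finset E :=
  Finset.univ.filter (crosses ends A)

/-- The value of the 2-way cut determined by the vertex set `A`. -/
noncomputable def cutValue {V E : Type} [Fintype E] (ends : E → Sym2 V) (A : Finset V) : ℕ :=
  (cutEdges ends A).card

/-- When each edge fails independently with probability `p`, this is the probability that the
(random) set of failed edges is a member of `S`. -/
noncomputable def failurePr {E : Type} [Fintype E] (p : ℝ) (S : Finset (Finset E)) : ℝ :=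
  ∑ F ∈ S, p ^ F.card * (1 - p) ^ (Fintype.card E - F.card)

/-- The probability that exactly the edges in `F` fail. -/
noncomputable def failureWeight {E : Type} [Fintype E] (p : ℝ) (F : Finset E) : ℝ :=
  p ^ F.card * (1 - p) ^ (Fintype.card E - F.card)

lemma failureWeight_nonneg {E : Type} [Fintype E] {p : ℝ} (hp0 : 0 ≤ p) (hp1 : p ≤ 1)
    (F : Finset E) : 0 ≤ failureWeight p F :=
  mul_nonneg (pow_nonneg hp0 _) (pow_nonneg (sub_nonneg.2 hp1) _)

/-- The expectation of `g F`, where `F` is the random set of failed edges. -/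
noncomputable def failureExp {E : Type} [Fintype E] (g : Finset E → ℝ) (p : ℝ) : ℝ :=
  ∑ F, failureWeight p F * g F

lemma failureExp_one {E : Type} [Fintype E] (g : Finset E → ℝ) :
    failureExp g 1 = g Finset.univ := by
  unfold failureExp failureWeight
  rw [Finset.sum_eq_single Finset.univ]
  · simp
  · intro F _ hF
    have h : F.card < Fintype.card E := Finset.card_lt_univ_of_notMem
      (x := (by simpa [Finset.eq_univ_iff_forall] using hF : ∃ x, x ∉ F).choose)
      (by simpa [Finset.eq_univ_iff_forall] using hF : ∃ x, x ∉ F).choose_spec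
    simp [Nat.sub_ne_zero_of_lt h]
  · simp

lemma sum_erase_eq_sum_insert {E : Type} [Fintype E] (f : Finset E → Finset E → ℝ) :
    ∑ F : Finset E, ∑ e ∈ F, f F (F.erase e) = ∑ F : Finset E, ∑ e ∈ Fᶜ, f (insert e F) F := by
  rw [Finset.sum_sigma', Finset.sum_sigma']
  refine Finset.sum_bij' (fun x _ => ⟨x.1.erase x.2, x.2⟩) (fun x _ => ⟨insert x.2 x.1, x.2⟩)
    ?_ ?_ ?_ ?_ ?_
  · rintro ⟨F, e⟩ h; simp
  · rintro ⟨F, e⟩ h; simp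
  · rintro ⟨F, e⟩ h
    have : e ∈ F := by simpa using h
    simp [Finset.insert_erase this]
  · rintro ⟨F, e⟩ h
    have : e ∉ F := by simpa using h
    simp [Finset.erase_insert this]
  · rintro ⟨F, e⟩ h
    have : e ∈ F := by simpa using h
    simp [Finset.insert_erase this]

lemma hasDerivAt_failureWeight {E : Type} [Fintype E] (F : Finset E) (p : ℝ) :
    ∃ d, HasDerivAt (fun q => failureWeight q F) d p ∧
      p * d = F.card * failureWeight p F - ∑ e ∈ Fᶜ, failureWeight p (insert e F) := by
  refine ⟨_, (hasDerivAt_pow F.card p).mul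
    (((hasDerivAt_id p).const_sub 1).pow (Fintype.card E - F.card)), ?_⟩
  have hsum : ∑ e ∈ Fᶜ, failureWeight p (insert e F) =
      (Fintype.card E - F.card : ℕ) *
        (p ^ (F.card + 1) * (1 - p) ^ (Fintype.card E - F.card - 1)) := by
    rw [Finset.sum_congr rfl (g := fun _ =>
      p ^ (F.card + 1) * (1 - p) ^ (Fintype.card E - F.card - 1))]
    · simp [Finset.card_compl]
    · intro e he
      rw [failureWeight, Finset.card_insert_of_notMem (by simpa using he), Nat.sub_sub]
  have hpow : (F.card : ℝ) * p ^ F.card = F.card * (p * p ^ (F.card - 1)) := by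
    rcases Nat.eq_zero_or_pos F.card with h | h
    · simp [h]
    · rw [← pow_succ', Nat.sub_add_cancel h]
  rw [hsum, failureWeight, id_eq]
  linear_combination -((1 - p) ^ (Fintype.card E - F.card)) * hpow

/-- Russo's formula. -/
lemma hasDerivAt_failureExp {E : Type} [Fintype E] (g : Finset E → ℝ) (p : ℝ) :
    ∃ d, HasDerivAt (failureExp g) d p ∧
      p * d = ∑ F : Finset E, ∑ e ∈ F, failureWeight p F * (g F - g (F.erase e)) := by
  choose d hd hpd using fun F : Finset E => hasDerivAt_failureWeight F p
  refine ⟨∑ F, d F * g F, ?_, ?_⟩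
  · exact HasDerivAt.fun_sum fun F _ => (hd F).mul_const (g F)
  · simp only [mul_sub, Finset.sum_sub_distrib]
    rw [sum_erase_eq_sum_insert fun F F' => failureWeight p F * g F', Finset.mul_sum,
      ← Finset.sum_sub_distrib]
    refine Finset.sum_congr rfl fun F _ => ?_
    rw [← mul_assoc, hpd, sub_mul, Finset.sum_mul, Finset.sum_const, nsmul_eq_mul, mul_assoc]

/-- If the logarithmic derivative of the expectation with respect to `log p` is at least `a`, then
the expectation decays at least like `p ^ a`. -/
lemma failureExp_le_of_le_sum {E : Type} [Fintype E] (g : Finset E → ℝ) (a : ℝ)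
    (h : ∀ F, a * g F ≤ ∑ e ∈ F, (g F - g (F.erase e))) {p : ℝ} (hp0 : 0 < p) (hp1 : p ≤ 1) :
    failureExp g p ≤ g Finset.univ * p ^ a := by
  choose d hd hpd using hasDerivAt_failureExp g
  have hderiv : ∀ q : ℝ, 0 < q →
      HasDerivAt (fun q => failureExp g q * q ^ (-a))
        (d q * q ^ (-a) + failureExp g q * (-a * q ^ (-a - 1))) q := fun q hq =>
    (hd q).mul (Real.hasDerivAt_rpow_const (Or.inl hq.ne'))
  have hmono : MonotoneOn (fun q => failureExp g q * q ^ (-a)) (Set.Icc p 1) := by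
    apply monotoneOn_of_deriv_nonneg (convex_Icc p 1)
    · exact fun q hq => (hderiv q (hp0.trans_le hq.1)).continuousAt.continuousWithinAt
    · rw [interior_Icc]
      exact fun q hq => (hderiv q (hp0.trans hq.1)).differentiableAt.differentiableWithinAt
    · rw [interior_Icc]
      intro q hq
      have hq0 : 0 < q := hp0.trans hq.1
      rw [(hderiv q hq0).deriv, Real.rpow_sub_one hq0.ne']
      have key : a * failureExp g q ≤ q * d q := by
        rw [hpd, failureExp, Finset.mul_sum]
        refine Finset.sum_le_sum fun F _ => ?_
        rw [← Finset.mul_sum, mul_left_comm]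
        exact mul_le_mul_of_nonneg_left (h F) (failureWeight_nonneg hq0.le hq.2.le F)
      have heq : d q * q ^ (-a) + failureExp g q * (-a * (q ^ (-a) / q)) =
          (q * d q - a * failureExp g q) * (q ^ (-a) / q) := by
        field_simp
        ring
      rw [heq]
      exact mul_nonneg (sub_nonneg.2 key) (div_nonneg (Real.rpow_nonneg hq0.le _) hq0.le)
  have := hmono ⟨le_rfl, hp1⟩ ⟨hp1, le_rfl⟩ hp1
  simp only [Real.one_rpow, mul_one, failureExp_one] at this
  rwa [Real.rpow_neg hp0.le, ← div_eq_mul_inv, div_le_iff₀ (Real.rpow_pos_of_pos hp0 a)] at this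

lemma survGraph_anti {V E : Type} (ends : E → Sym2 V) {F F' : Finset E} (h : F ⊆ F') :
    survGraph ends F' ≤ survGraph ends F := by
  intro x y hxy
  simp only [survGraph, SimpleGraph.fromRel_adj] at hxy ⊢
  exact ⟨hxy.1, hxy.2.imp (fun ⟨e, he, h'⟩ => ⟨e, fun he' => he (h he'), h'⟩)
    (fun ⟨e, he, h'⟩ => ⟨e, fun he' => he (h he'), h'⟩)⟩

lemma survGraph_adj_of_notMem {V E : Type} (ends : E → Sym2 V) {F : Finset E} {e : E}
    {x y : V} (he : e ∉ F) (hxy : ends e = s(x, y)) (hne : x ≠ y) :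
    (survGraph ends F).Adj x y := by
  simp only [survGraph, SimpleGraph.fromRel_adj]
  exact ⟨hne, Or.inl ⟨e, he, hxy⟩⟩

/-- Edge `e` joins two different components of the graph surviving the failure of `F`. -/
def JoinsComponents {V E : Type} (ends : E → Sym2 V) (F : Finset E) (e : E) : Prop :=
  ∃ x y, ends e = s(x, y) ∧ (survGraph ends F).connectedComponentMk x ≠
    (survGraph ends F).connectedComponentMk y

lemma JoinsComponents.mem {V E : Type} {ends : E → Sym2 V} {F : Finset E} {e : E}
    (h : JoinsComponents ends F e) : e ∈ F := by
  obtain ⟨x, y, hxy, hne⟩ := h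
  by_contra he
  refine hne (SimpleGraph.ConnectedComponent.sound
    (survGraph_adj_of_notMem ends he hxy ?_).reachable)
  rintro rfl
  exact hne rfl

lemma connectedComponent_map_surjective {V : Type} {G H : SimpleGraph V} (h : G ≤ H) :
    Function.Surjective
      (SimpleGraph.ConnectedComponent.map (SimpleGraph.Hom.ofLE h)) := by
  intro C
  induction C using SimpleGraph.ConnectedComponent.ind with
  | h v => exact ⟨G.connectedComponentMk v, rfl⟩

lemma numComponents_mono {V E : Type} [Fintype V] (ends : E → Sym2 V) {F F' : Finset E}
    (h : F ⊆ F') : numComponents ends F ≤ numComponents ends F' :=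
  Nat.card_le_card_of_surjective _ (connectedComponent_map_surjective (survGraph_anti ends h))

lemma numComponents_le_card {V E : Type} [Fintype V] (ends : E → Sym2 V) (F : Finset E) :
    numComponents ends F ≤ Fintype.card V := by
  rw [← Nat.card_eq_fintype_card]
  exact Nat.card_le_card_of_surjective (survGraph ends F).connectedComponentMk Quot.mk_surjective

lemma JoinsComponents.numComponents_erase_lt {V E : Type} [Fintype V] {ends : E → Sym2 V}
    {F : Finset E} {e : E} (h : JoinsComponents ends F e) :
    numComponents ends (F.erase e) < numComponents ends F := by
  have hsurj := connectedComponent_map_surjective (survGraph_anti ends (F.erase_subset e))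
  refine lt_of_le_of_ne (numComponents_mono ends (F.erase_subset e)) fun heq => ?_
  have hbij := (Nat.bijective_iff_surjective_and_card _).2 ⟨hsurj, heq.symm⟩
  obtain ⟨x, y, hxy, hne⟩ := h
  refine hne (hbij.1 (SimpleGraph.ConnectedComponent.sound (SimpleGraph.Adj.reachable ?_)))
  refine survGraph_adj_of_notMem ends (Finset.notMem_erase e F) hxy ?_
  rintro rfl
  exact hne rfl

/-- If the surviving graph is disconnected, then every component is left by at least `c` edges,
and every edge joining different components leaves two of them. -/
lemma numComponents_mul_le {V E : Type} [Fintype V] [DecidableEq V] [Fintype E]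
    (ends : E → Sym2 V) {c : ℕ}
    (hmin : ∀ A : Finset V, A.Nonempty → Aᶜ.Nonempty → c ≤ cutValue ends A) (F : Finset E)
    (hK : 2 ≤ numComponents ends F) :
    numComponents ends F * c ≤ 2 * (F.filter (JoinsComponents ends F)).card := by
  let G := survGraph ends F
  let A : G.ConnectedComponent → Finset V :=
    fun C => Finset.univ.filter fun v => G.connectedComponentMk v = C
  have hA : ∀ C, c ≤ cutValue ends (A C) := by
    intro C
    have : Nontrivial G.ConnectedComponent := Finite.one_lt_card_iff_nontrivial.1 hK
    obtain ⟨C', hC'⟩ := exists_ne C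
    obtain ⟨v, rfl⟩ := Quot.exists_rep C
    obtain ⟨v', rfl⟩ := Quot.exists_rep C'
    refine hmin _ ⟨v, ?_⟩ ⟨v', ?_⟩
    · simp only [A, Finset.mem_filter, Finset.mem_univ, true_and]; rfl
    · simp only [A, Finset.mem_compl, Finset.mem_filter, Finset.mem_univ, true_and]; exact hC'
  have hsub : ∀ C, cutEdges ends (A C) ⊆ F.filter (JoinsComponents ends F) := by
    intro C e he
    simp only [cutEdges, crosses, Finset.mem_filter, Finset.mem_univ, true_and, A] at he
    obtain ⟨⟨x, hx, hxC⟩, y, hy, hyC⟩ := he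
    have hne : G.connectedComponentMk x ≠ G.connectedComponentMk y := fun h =>
      hyC (h.symm.trans hxC)
    have hj : JoinsComponents ends F e :=
      ⟨x, y, (Sym2.mem_and_mem_iff (fun h => hne (congrArg _ h))).1 ⟨hx, hy⟩, hne⟩
    exact Finset.mem_filter.2 ⟨hj.mem, hj⟩
  have hfib : ∀ e, (Finset.univ.filter fun C => e ∈ cutEdges ends (A C)).card ≤ 2 := by
    intro e
    obtain ⟨⟨x, y⟩, hxy⟩ := Quot.exists_rep (ends e)
    change s(x, y) = ends e at hxy
    refine (Finset.card_le_card ?_).trans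
      (Finset.card_le_two (a := G.connectedComponentMk x) (b := G.connectedComponentMk y))
    intro C hC
    simp only [cutEdges, crosses, Finset.mem_filter, Finset.mem_univ, true_and, A, ← hxy] at hC
    obtain ⟨⟨z, hz, hzC⟩, -⟩ := hC
    rcases Sym2.mem_iff.1 hz with rfl | rfl <;> simp [← hzC]
  calc numComponents ends F * c = ∑ _C : G.ConnectedComponent, c := by
        simp [numComponents, Nat.card_eq_fintype_card, G]
    _ ≤ ∑ C : G.ConnectedComponent, (cutEdges ends (A C)).card :=
        Finset.sum_le_sum fun C _ => hA C
    _ = ∑ C : G.ConnectedComponent,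
          ((F.filter (JoinsComponents ends F)).filter (· ∈ cutEdges ends (A C))).card := by
        refine Finset.sum_congr rfl fun C _ => congrArg _ ?_
        rw [Finset.filter_mem_eq_inter, Finset.inter_eq_right.2 (hsub C)]
    _ = ∑ e ∈ F.filter (JoinsComponents ends F),
          (Finset.univ.filter fun C => e ∈ cutEdges ends (A C)).card :=
        Finset.sum_card_bipartiteAbove_eq_sum_card_bipartiteBelow fun C e => e ∈ cutEdges ends (A C)
    _ ≤ ∑ _e ∈ F.filter (JoinsComponents ends F), 2 := Finset.sum_le_sum fun e _ => hfib e
    _ = 2 * (F.filter (JoinsComponents ends F)).card := by simp [mul_comm]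

lemma choose_numComponents_le_sum {V E : Type} [Fintype V] [DecidableEq V] [Fintype E]
    (ends : E → Sym2 V) {c : ℕ}
    (hmin : ∀ A : Finset V, A.Nonempty → Aᶜ.Nonempty → c ≤ cutValue ends A) {r : ℕ} (hr : 2 ≤ r)
    (F : Finset E) :
    ((r : ℝ) * c / 2) * (numComponents ends F).choose r ≤
      ∑ e ∈ F, (((numComponents ends F).choose r : ℝ) -
        (numComponents ends (F.erase e)).choose r) := by
  have hnonneg : ∀ e ∈ F, (0 : ℝ) ≤ ((numComponents ends F).choose r : ℝ) -
      (numComponents ends (F.erase e)).choose r := fun e _ => sub_nonneg.2 (by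
    exact_mod_cast Nat.choose_le_choose r (numComponents_mono ends (F.erase_subset e)))
  rcases lt_or_ge (numComponents ends F) r with hlt | hge
  · rw [Nat.choose_eq_zero_of_lt hlt] at hnonneg ⊢
    simpa using Finset.sum_nonneg hnonneg
  obtain ⟨s, rfl⟩ : ∃ s, r = s + 1 := ⟨r - 1, by omega⟩
  obtain ⟨k, hk⟩ : ∃ k, numComponents ends F = k + 1 := ⟨numComponents ends F - 1, by omega⟩
  have hcount := numComponents_mul_le ends hmin F (hr.trans hge)
  have hterm : ∀ e ∈ F.filter (JoinsComponents ends F), (k.choose s : ℝ) ≤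
      ((numComponents ends F).choose (s + 1) : ℝ) -
        (numComponents ends (F.erase e)).choose (s + 1) := by
    intro e he
    have hlt := (Finset.mem_filter.1 he).2.numComponents_erase_lt
    have hle : (numComponents ends (F.erase e)).choose (s + 1) ≤ k.choose (s + 1) :=
      Nat.choose_le_choose _ (by omega)
    have hle' : ((numComponents ends (F.erase e)).choose (s + 1) : ℝ) ≤ k.choose (s + 1) := by
      exact_mod_cast hle
    rw [hk, Nat.choose_succ_succ]
    push_cast
    linarith
  have habsorb : ((k + 1 : ℕ) : ℝ) * k.choose s = (k + 1).choose (s + 1) * ((s + 1 : ℕ) : ℝ) := by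
    exact_mod_cast Nat.add_one_mul_choose_eq k s
  have hcount' : ((k + 1 : ℕ) : ℝ) * c ≤ 2 * (F.filter (JoinsComponents ends F)).card := by
    rw [hk] at hcount
    exact_mod_cast hcount
  calc (((s + 1 : ℕ) : ℝ) * c / 2) * (numComponents ends F).choose (s + 1)
      = ((k + 1 : ℕ) : ℝ) * c / 2 * k.choose s := by
        rw [hk]; linear_combination (-(c : ℝ) / 2) * habsorb
    _ ≤ (F.filter (JoinsComponents ends F)).card * (k.choose s : ℝ) := by
        gcongr
        linarith
    _ = ∑ _e ∈ F.filter (JoinsComponents ends F), (k.choose s : ℝ) := by simp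
    _ ≤ _ := Finset.sum_le_sum hterm
    _ ≤ _ := Finset.sum_le_sum_of_subset_of_nonneg (Finset.filter_subset _ _)
        fun e he _ => hnonneg e he

/-- The probability of at least `r` surviving components is at most that of at least `r` failures
among `n` independent events of probability `p ^ (c / 2)`, in its union bound form. -/
lemma failurePr_le_numComponents {V E : Type} [Fintype V] [DecidableEq V] [Fintype E]
    (ends : E → Sym2 V) {c : ℕ}
    (hmin : ∀ A : Finset V, A.Nonempty → Aᶜ.Nonempty → c ≤ cutValue ends A) {r : ℕ} (hr : 2 ≤ r)
    {p : ℝ} (hp0 : 0 < p) (hp1 : p ≤ 1) (S : Finset (Finset E))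
    (hS : ∀ F ∈ S, r ≤ numComponents ends F) :
    failurePr p S ≤ (Fintype.card V).choose r * p ^ ((r : ℝ) * c / 2) := by
  let g : Finset E → ℝ := fun F => (numComponents ends F).choose r
  have hg : ∀ F, 0 ≤ g F := fun F => Nat.cast_nonneg _
  calc failurePr p S = ∑ F ∈ S, failureWeight p F := rfl
    _ ≤ ∑ F ∈ S, failureWeight p F * g F := Finset.sum_le_sum fun F hF =>
        le_mul_of_one_le_right (failureWeight_nonneg hp0.le hp1 F)
          (Nat.one_le_cast.2 (Nat.choose_pos (hS F hF)))
    _ ≤ failureExp g p := Finset.sum_le_sum_of_subset_of_nonneg (Finset.subset_univ _)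
        fun F _ _ => mul_nonneg (failureWeight_nonneg hp0.le hp1 F) (hg F)
    _ ≤ g Finset.univ * p ^ ((r : ℝ) * c / 2) :=
        failureExp_le_of_le_sum g _ (choose_numComponents_le_sum ends hmin hr) hp0 hp1
    _ ≤ _ := by
        refine mul_le_mul_of_nonneg_right ?_ (Real.rpow_nonneg hp0.le _)
        exact Nat.cast_le.2 (Nat.choose_le_choose r (numComponents_le_card ends Finset.univ))

lemma cutEdges_compl {V E : Type} [Fintype V] [DecidableEq V] [Fintype E] (ends : E → Sym2 V)
    (A : Finset V) : cutEdges ends Aᶜ = cutEdges ends A := by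
  ext e
  simp only [cutEdges, crosses, Finset.mem_filter, Finset.mem_compl, not_not, and_comm]

lemma mem_iff_of_connectedComponentMk_eq {V E : Type} [Fintype E]
    {ends : E → Sym2 V} {A : Finset V} {F : Finset E} (hA : cutEdges ends A ⊆ F) {x y : V}
    (h : (survGraph ends F).connectedComponentMk x = (survGraph ends F).connectedComponentMk y) :
    x ∈ A ↔ y ∈ A := by
  obtain ⟨w⟩ := SimpleGraph.ConnectedComponent.exact h
  clear h
  induction w with
  | nil => rfl
  | @cons a b _ hab _ ih =>
    refine Iff.trans ?_ ih
    simp only [survGraph, SimpleGraph.fromRel_adj] at hab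
    obtain ⟨e, he, hend⟩ : ∃ e, e ∉ F ∧ ends e = s(a, b) := by
      rcases hab.2 with h | ⟨e, he, h⟩
      · exact h
      · exact ⟨e, he, h.trans Sym2.eq_swap⟩
    by_contra hne
    refine he (hA ?_)
    simp only [cutEdges, crosses, Finset.mem_filter, Finset.mem_univ, true_and, hend,
      Sym2.mem_iff]
    by_cases ha : a ∈ A <;> by_cases hb : b ∈ A
    · simp [ha, hb] at hne
    · exact ⟨⟨a, Or.inl rfl, ha⟩, b, Or.inr rfl, hb⟩
    · exact ⟨⟨b, Or.inr rfl, hb⟩, a, Or.inl rfl, ha⟩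
    · simp [ha, hb] at hne

lemma card_filter_cutEdges_subset_le {V E : Type} [Fintype V] [Fintype E] (ends : E → Sym2 V)
    (F : Finset E) :
    (Finset.univ.filter fun A : Finset V => cutEdges ends A ⊆ F).card ≤
      2 ^ numComponents ends F := by
  let G := survGraph ends F
  have hcard : (Finset.univ : Finset (Finset G.ConnectedComponent)).card =
      2 ^ numComponents ends F := by
    simp [numComponents, Nat.card_eq_fintype_card, G]
  rw [← hcard]
  have key : ∀ A B : Finset V, cutEdges ends B ⊆ F →
      A.image G.connectedComponentMk = B.image G.connectedComponentMk → A ⊆ B := by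
    intro A B hB h x hx
    have hx' := h ▸ Finset.mem_image_of_mem G.connectedComponentMk hx
    obtain ⟨y, hy, hyx⟩ := Finset.mem_image.1 hx'
    exact (mem_iff_of_connectedComponentMk_eq hB hyx).1 hy
  refine Finset.card_le_card_of_injOn (fun A => A.image G.connectedComponentMk)
    (fun _ _ => Finset.mem_coe.2 (Finset.mem_univ _)) fun A hA B hB h => ?_
  simp only [Finset.coe_filter, Finset.mem_univ, true_and, Set.mem_ofPred_eq] at hA hB
  exact (key A B hB h).antisymm (key B A hA h.symm)

lemma two_mul_card_cuts_add_two_le {V E : Type} [Fintype V] [DecidableEq V] [Nonempty V]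
    [Fintype E] (ends : E → Sym2 V) (F : Finset E) :
    2 * ((Finset.univ.filter (fun A : Finset V =>
            A.Nonempty ∧ Aᶜ.Nonempty ∧ cutEdges ends A ⊆ F)).image
              (fun A => ({A, Aᶜ} : Finset (Finset V)))).card + 2 ≤ 2 ^ numComponents ends F := by
  refine le_trans ?_ (card_filter_cutEdges_subset_le ends F)
  set T := Finset.univ.filter (fun A : Finset V =>
            A.Nonempty ∧ Aᶜ.Nonempty ∧ cutEdges ends A ⊆ F) with hT
  have hpair : 2 * (T.image (fun A => ({A, Aᶜ} : Finset (Finset V)))).card ≤ T.card := by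
    refine Finset.mul_card_image_le_card T 2 fun P hP => ?_
    obtain ⟨A, hA, rfl⟩ := Finset.mem_image.1 hP
    have hAc : Aᶜ ∈ T := by
      simp only [hT, Finset.mem_filter, Finset.mem_univ, true_and, compl_compl,
        cutEdges_compl] at hA ⊢
      exact ⟨hA.2.1, hA.1, hA.2.2⟩
    rw [← Finset.card_pair (ne_compl_self (a := A))]
    refine Finset.card_le_card fun B hB => ?_
    rcases Finset.mem_insert.1 hB with rfl | hB
    · simp [hA]
    · rw [Finset.mem_singleton.1 hB]
      simp [hAc, Finset.pair_comm]
  have hne : (∅ : Finset V) ≠ Finset.univ := Finset.univ_nonempty.ne_empty.symm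
  have hdisj : Disjoint T {∅, Finset.univ} := by
    rw [Finset.disjoint_right]
    simp [hT]
  calc _ ≤ T.card + ({∅, Finset.univ} : Finset (Finset V)).card := by
        rw [Finset.card_pair hne]; omega
    _ = (T ∪ {∅, Finset.univ}).card := (Finset.card_union_of_disjoint hdisj).symm
    _ ≤ _ := Finset.card_le_card fun A hA => by
        rcases Finset.mem_union.1 hA with h | h
        · simp only [hT, Finset.mem_filter, Finset.mem_univ, true_and] at h ⊢
          exact h.2.2
        · have : cutEdges ends A = ∅ := by
            rcases Finset.mem_insert.1 h with rfl | h
            · simp [cutEdges, crosses]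
            · simp [cutEdges, crosses, Finset.mem_singleton.1 h]
          simp [this]

/-- Let `G` be a multigraph on `n ≥ 2` vertices with minimum cut value `c ≥ 1`
whose edges fail independently with probability `p ∈ [0,1]`, where `p ^ c = n ^ (-(2+δ))` for
some `δ > 0`.  Then for every integer `u ≥ 1`, the probability that the failed edge set contains
the edge sets of at least `u` distinct cuts of `G` is at most
`n ^ (-⌈log₂(u+1) + 1⌉ δ / 2)`. -/
theorem stmt16 {V E : Type} [Fintype V] [DecidableEq V] [Fintype E]
    (ends : E → Sym2 V) (hnd : ∀ e, ¬ (ends e).IsDiag)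
    (hn : 2 ≤ Fintype.card V) (c : ℕ) (hc : 1 ≤ c)
    (hmin : ∀ A : Finset V, A.Nonempty → Aᶜ.Nonempty → c ≤ cutValue ends A)
    (hex : ∃ A : Finset V, A.Nonempty ∧ Aᶜ.Nonempty ∧ cutValue ends A = c)
    (p δ : ℝ) (hp0 : 0 ≤ p) (hp1 : p ≤ 1) (hδ : 0 < δ)
    (hpc : p ^ c = (Fintype.card V : ℝ) ^ (-(2 + δ)))
    (u : ℕ) (hu : 1 ≤ u) :
    failurePr p (Finset.univ.filter (fun F : Finset E =>
        u ≤ ((Finset.univ.filter (fun A : Finset V =>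
            A.Nonempty ∧ Aᶜ.Nonempty ∧ cutEdges ends A ⊆ F)).image
              (fun A => ({A, Aᶜ} : Finset (Finset V)))).card))
      ≤ (Fintype.card V : ℝ) ^
          (-(((⌈Real.logb 2 ((u : ℝ) + 1) + 1⌉ : ℤ) : ℝ) * δ / 2)) := by
  have hn0 : (0 : ℝ) < Fintype.card V := by exact_mod_cast (by omega : 0 < Fintype.card V)
  have : Nonempty V := Fintype.card_pos_iff.1 (by omega)
  have hp : 0 < p := hp0.lt_of_ne' fun h => by
    rw [h, zero_pow (by omega)] at hpc
    exact (Real.rpow_pos_of_pos hn0 _).ne hpc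
  have hu1 : (1 : ℝ) ≤ Real.logb 2 ((u : ℝ) + 1) := by
    rw [Real.le_logb_iff_rpow_le (by norm_num) (by positivity), Real.rpow_one]
    have : (1 : ℝ) ≤ u := by exact_mod_cast hu
    linarith
  have hceil : (2 : ℤ) ≤ ⌈Real.logb 2 ((u : ℝ) + 1) + 1⌉ := by
    have := Int.le_ceil (Real.logb 2 ((u : ℝ) + 1) + 1)
    have h2 : (2 : ℝ) ≤ (⌈Real.logb 2 ((u : ℝ) + 1) + 1⌉ : ℤ) := by linarith
    exact_mod_cast h2
  obtain ⟨r, hr⟩ := Int.eq_ofNat_of_zero_le (by omega : 0 ≤ ⌈Real.logb 2 ((u : ℝ) + 1) + 1⌉)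
  rw [hr, Int.cast_natCast]
  refine (failurePr_le_numComponents ends hmin (r := r) (by omega) hp hp1 _ ?_).trans ?_
  · intro F hF
    have hcuts := two_mul_card_cuts_add_two_le ends F
    have huF := (Finset.mem_filter.1 hF).2
    have hpow : 2 * (u + 1) ≤ 2 ^ numComponents ends F := by omega
    have hpow' : (2 : ℝ) * ((u : ℝ) + 1) ≤ 2 ^ (numComponents ends F : ℝ) := by
      rw [Real.rpow_natCast]
      exact_mod_cast hpow
    have hlog : Real.logb 2 ((u : ℝ) + 1) + 1 ≤ numComponents ends F := by
      rw [← Real.logb_le_iff_le_rpow (by norm_num) (by positivity),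
        Real.logb_mul (by norm_num) (by positivity), Real.logb_self_eq_one (by norm_num)] at hpow'
      linarith
    have : ⌈Real.logb 2 ((u : ℝ) + 1) + 1⌉ ≤ (numComponents ends F : ℤ) :=
      Int.ceil_le.2 (by exact_mod_cast hlog)
    omega
  · have hpr : p ^ ((r : ℝ) * c / 2) = (Fintype.card V : ℝ) ^ (-(2 + δ) * (r / 2)) := by
      rw [Real.rpow_mul hn0.le, ← hpc, ← Real.rpow_natCast p c, ← Real.rpow_mul hp0]
      congr 1
      ring
    have hchoose : ((Fintype.card V).choose r : ℝ) ≤ (Fintype.card V : ℝ) ^ (r : ℝ) := by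
      rw [Real.rpow_natCast]
      exact_mod_cast Nat.choose_le_pow _ _
    calc _ ≤ (Fintype.card V : ℝ) ^ (r : ℝ) * p ^ ((r : ℝ) * c / 2) :=
          mul_le_mul_of_nonneg_right hchoose (Real.rpow_nonneg hp0 _)
      _ = _ := by
          rw [hpr, ← Real.rpow_add hn0]
          congr 1
          ring
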